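/- Let p ∈ (1,2]. Let ψ : [1,∞) → [1,∞) be an increasing function with ψ(1) = 1 such that, for every positive integer d and all weights w, σ on ℝ^d with [σ]_{A_∞} < ∞, one has ‖S(·σ)‖_{L^p(σ)→L^p(w)} ≤ C(p,d) · [w,σ]_{A_p}^{1/p} ψ([σ]_{A_∞}) for some constant C(p,d) depending only on p and d. Then there exists an absolute constant A > 0 such that ψ(x) ≥ c_p x^{1/p} for all x > A, where c_p > 0 depends only on p. -/

import Mathlib

open MeasureTheory Set Filter
open scoped ENNReal NNReal

noncomputable section

/-- The "cube" (axis-parallel box) `[a₁,b₁) × ⋯ × [a_d,b_d)` in `ℝ^d`. -/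
def cubeD (d : ℕ) (a b : Fin d → ℝ) : Set (Fin d → ℝ) :=
  Set.univ.pi fun i => Set.Ico (a i) (b i)

/-- Average of `g` over the cube `[a₁,b₁) × ⋯ × [a_d,b_d)`. -/
def cubeAvg (d : ℕ) (g : (Fin d → ℝ) → ℝ) (a b : Fin d → ℝ) : ℝ :=
  (∏ i, (b i - a i))⁻¹ * ∫ x in cubeD d a b, g x

/-- The dyadic cube `∏_i [kᵢ 2^{-n}, (kᵢ+1) 2^{-n})`. -/
def dcube (d : ℕ) (n : ℤ) (k : Fin d → ℤ) : Set (Fin d → ℝ) :=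
  cubeD d (fun i => (k i : ℝ) * (2:ℝ) ^ (-n)) (fun i => ((k i : ℝ) + 1) * (2:ℝ) ^ (-n))

/-- Average over the dyadic cube `dcube d n k`. -/
def dcubeAvg (d : ℕ) (g : (Fin d → ℝ) → ℝ) (n : ℤ) (k : Fin d → ℤ) : ℝ :=
  cubeAvg d g (fun i => (k i : ℝ) * (2:ℝ) ^ (-n)) (fun i => ((k i : ℝ) + 1) * (2:ℝ) ^ (-n))

/-- Index of the dyadic child of `dcube d n k` selected by `ε : Fin d → Bool`. -/
def childIdx (d : ℕ) (k : Fin d → ℤ) (ε : Fin d → Bool) : Fin d → ℤ :=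
  fun i => 2 * k i + (if ε i then 1 else 0)

/-- The martingale difference `Δ_Q g` associated with the dyadic cube `Q = dcube d n k`:
`Δ_Q g = Σ_{R child of Q} ⟨g⟩_R 1_R − ⟨g⟩_Q 1_Q`. -/
def deltaCube (d : ℕ) (g : (Fin d → ℝ) → ℝ) (n : ℤ) (k : Fin d → ℤ) (x : Fin d → ℝ) : ℝ :=
  (∑ ε : Fin d → Bool,
    (dcube d (n+1) (childIdx d k ε)).indicator
      (fun _ => dcubeAvg d g (n+1) (childIdx d k ε)) x)
  - (dcube d n k).indicator (fun _ => dcubeAvg d g n k) x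

/-- The dyadic square function on `ℝ^d`. -/
def sqFnD (d : ℕ) (g : (Fin d → ℝ) → ℝ) (x : Fin d → ℝ) : ℝ :=
  Real.sqrt (∑' q : ℤ × (Fin d → ℤ), (deltaCube d g q.1 q.2 x) ^ 2)

/-- `‖g‖_{L^p(w)}` on `ℝ^d` (as an extended nonnegative real). -/
def pNormD (d : ℕ) (p : ℝ) (g w : (Fin d → ℝ) → ℝ) : ℝ≥0∞ :=
  (∫⁻ x : Fin d → ℝ, ENNReal.ofReal (|g x| ^ p * w x)) ^ (1/p)

/-- The joint `A_p` characteristic `[w,σ]_{A_p}` on `ℝ^d`, the supremum running over all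
cubes. -/
def apCharD (d : ℕ) (p : ℝ) (w σ : (Fin d → ℝ) → ℝ) : ℝ≥0∞ :=
  ⨆ (a : Fin d → ℝ) (b : Fin d → ℝ) (_ : ∀ i, a i < b i),
    ENNReal.ofReal (cubeAvg d w a b * (cubeAvg d σ a b) ^ (p - 1))

/-- Local maximal function `M_Q σ (x) = sup { ⟨σ⟩_R : R cube ⊆ Q, x ∈ R }` for the cube
`Q = cubeD d a b`. -/
def maxFnD (d : ℕ) (σ : (Fin d → ℝ) → ℝ) (a b x : Fin d → ℝ) : ℝ≥0∞ :=
  ⨆ (c : Fin d → ℝ) (e : Fin d → ℝ) (_ : ∀ i, c i < e i)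
    (_ : cubeD d c e ⊆ cubeD d a b) (_ : x ∈ cubeD d c e),
      ENNReal.ofReal (cubeAvg d σ c e)

/-- The Fujii–Wilson `A_∞` characteristic on `ℝ^d`:
`[σ]_{A_∞} = sup_Q (1/σ(Q)) ∫_Q M_Q σ`, the supremum over all cubes. -/
def ainfCharD (d : ℕ) (σ : (Fin d → ℝ) → ℝ) : ℝ≥0∞ :=
  ⨆ (a : Fin d → ℝ) (b : Fin d → ℝ) (_ : ∀ i, a i < b i),
    (∫⁻ x in cubeD d a b, maxFnD d σ a b x) /
      ENNReal.ofReal (∫ x in cubeD d a b, σ x)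

/-- A weight on `ℝ^d`: measurable, a.e. positive, and integrable over every cube. -/
def IsWeightD (d : ℕ) (w : (Fin d → ℝ) → ℝ) : Prop :=
  Measurable w ∧ (∀ᵐ x : Fin d → ℝ, 0 < w x) ∧
    ∀ a b : Fin d → ℝ, (∀ i, a i < b i) → IntegrableOn w (cubeD d a b)

/-- A one-dimensional box is the preimage of an interval under evaluation. -/
theorem cubeD_one (a b : Fin 1 → ℝ) :
    cubeD 1 a b = MeasurableEquiv.funUnique (Fin 1) ℝ ⁻¹' Set.Ico (a 0) (b 0) := by
  ext x
  simp [cubeD, Set.mem_pi]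

theorem mem_cubeD_one {a b x : Fin 1 → ℝ} :
    x ∈ cubeD 1 a b ↔ a 0 ≤ x 0 ∧ x 0 < b 0 := by
  simp [cubeD, Set.mem_pi]

theorem setIntegral_cubeD_one (G : ℝ → ℝ) (a b : Fin 1 → ℝ) :
    ∫ x in cubeD 1 a b, G (x 0) = ∫ t in Set.Ico (a 0) (b 0), G t := by
  rw [cubeD_one]
  exact (volume_preserving_funUnique (Fin 1) ℝ).setIntegral_preimage_emb
    (MeasurableEquiv.measurableEmbedding _) G _

theorem cubeAvg_one (G : ℝ → ℝ) (a b : Fin 1 → ℝ) :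
    cubeAvg 1 (fun x => G (x 0)) a b =
      (b 0 - a 0)⁻¹ * ∫ t in Set.Ico (a 0) (b 0), G t := by
  simp [cubeAvg, setIntegral_cubeD_one]

theorem integrableOn_cubeD_one {G : ℝ → ℝ} {a b : Fin 1 → ℝ}
    (hG : IntegrableOn G (Set.Ico (a 0) (b 0))) :
    IntegrableOn (fun x : Fin 1 → ℝ => G (x 0)) (cubeD 1 a b) := by
  rw [cubeD_one]
  exact ((volume_preserving_funUnique (Fin 1) ℝ).integrableOn_comp_preimage
    (MeasurableEquiv.measurableEmbedding _)).2 hG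

theorem lintegral_fin_one (G : ℝ → ℝ≥0∞) :
    ∫⁻ x : Fin 1 → ℝ, G (x 0) = ∫⁻ t, G t :=
  (volume_preserving_funUnique (Fin 1) ℝ).lintegral_comp_emb
    (MeasurableEquiv.measurableEmbedding _) G

theorem ae_fin_one_ne_zero : ∀ᵐ x : Fin 1 → ℝ, x 0 ≠ 0 :=
  (volume_preserving_funUnique (Fin 1) ℝ).quasiMeasurePreserving.ae
    (p := fun t : ℝ => t ≠ 0) (Measure.ae_ne volume 0)

/-- The average of `G` over the dyadic interval of length `2 ^ (-n)` containing `t`. -/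
def dyadicAvg (G : ℝ → ℝ) (n : ℤ) (t : ℝ) : ℝ :=
  (2 : ℝ) ^ n * ∫ s in Set.Ico ((⌊t * (2 : ℝ) ^ n⌋ : ℝ) * (2 : ℝ) ^ (-n))
    (((⌊t * (2 : ℝ) ^ n⌋ : ℝ) + 1) * (2 : ℝ) ^ (-n)), G s

theorem mem_dcube_one {n : ℤ} {k : Fin 1 → ℤ} {x : Fin 1 → ℝ} :
    x ∈ dcube 1 n k ↔ ⌊x 0 * (2 : ℝ) ^ n⌋ = k 0 := by
  have h : (0 : ℝ) < (2 : ℝ) ^ n := by positivity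
  rw [dcube, mem_cubeD_one, Int.floor_eq_iff, zpow_neg, ← div_eq_mul_inv, ← div_eq_mul_inv,
    div_le_iff₀ h, lt_div_iff₀ h]

theorem dcubeAvg_one (G : ℝ → ℝ) {n : ℤ} {k : Fin 1 → ℤ} {t : ℝ}
    (hk : ⌊t * (2 : ℝ) ^ n⌋ = k 0) :
    dcubeAvg 1 (fun x => G (x 0)) n k = dyadicAvg G n t := by
  rw [dcubeAvg, cubeAvg_one, dyadicAvg, hk]
  congr 1
  rw [zpow_neg]
  ring_nf
  simp

theorem floor_mul_zpow_succ (t : ℝ) (n : ℤ) :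
    ⌊t * (2 : ℝ) ^ (n + 1)⌋ = 2 * ⌊t * (2 : ℝ) ^ n⌋ ∨
      ⌊t * (2 : ℝ) ^ (n + 1)⌋ = 2 * ⌊t * (2 : ℝ) ^ n⌋ + 1 := by
  have h1 := Int.floor_le (t * (2 : ℝ) ^ n)
  have h2 := Int.lt_floor_add_one (t * (2 : ℝ) ^ n)
  have e : t * (2 : ℝ) ^ (n + 1) = 2 * (t * (2 : ℝ) ^ n) := by
    rw [zpow_add_one₀ two_ne_zero]; ring
  rw [e]
  have h3 : 2 * ⌊t * (2 : ℝ) ^ n⌋ ≤ ⌊2 * (t * (2 : ℝ) ^ n)⌋ := by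
    rw [Int.le_floor]; push_cast; linarith
  have h4 : ⌊2 * (t * (2 : ℝ) ^ n)⌋ < 2 * ⌊t * (2 : ℝ) ^ n⌋ + 2 := by
    rw [Int.floor_lt]; push_cast; linarith
  omega

theorem deltaCube_one (G : ℝ → ℝ) (n : ℤ) (k : Fin 1 → ℤ) (x : Fin 1 → ℝ) :
    deltaCube 1 (fun y => G (y 0)) n k x =
      if ⌊x 0 * (2 : ℝ) ^ n⌋ = k 0 then dyadicAvg G (n + 1) (x 0) - dyadicAvg G n (x 0)
      else 0 := by
  have hind (m : ℤ) (l : Fin 1 → ℤ) :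
      (dcube 1 m l).indicator (fun _ => dcubeAvg 1 (fun y => G (y 0)) m l) x =
        if ⌊x 0 * (2 : ℝ) ^ m⌋ = l 0 then dyadicAvg G m (x 0) else 0 := by
    by_cases h : ⌊x 0 * (2 : ℝ) ^ m⌋ = l 0
    · rw [Set.indicator_of_mem (mem_dcube_one.2 h), if_pos h, dcubeAvg_one G h]
    · rw [Set.indicator_of_notMem (fun hx => h (mem_dcube_one.1 hx)), if_neg h]
  have hsum (F : (Fin 1 → Bool) → ℝ) :
      ∑ ε, F ε = F (fun _ => true) + F (fun _ => false) := by
    rw [← (Equiv.funUnique (Fin 1) Bool).symm.sum_comp, Fintype.sum_bool]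
    rfl
  simp only [deltaCube, hind, hsum, childIdx]
  rcases floor_mul_zpow_succ (x 0) n with h | h <;>
    by_cases hk : ⌊x 0 * (2 : ℝ) ^ n⌋ = k 0 <;> rw [h] <;> simp [hk] <;> grind

theorem abs_dyadicAvg_le {G : ℝ → ℝ} (hG : Integrable G) (n : ℤ) (t : ℝ) :
    |dyadicAvg G n t| ≤ (2 : ℝ) ^ n * ∫ s, |G s| := by
  rw [dyadicAvg, abs_mul, abs_of_pos (by positivity : (0 : ℝ) < (2 : ℝ) ^ n)]
  gcongr
  exact abs_integral_le_integral_abs.trans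
    (setIntegral_le_integral hG.abs (ae_of_all _ fun s => abs_nonneg _))

theorem dyadicAvg_of_eqOn_const {G : ℝ → ℝ} {n : ℤ} {t c : ℝ}
    (h : ∀ s ∈ Set.Ico ((⌊t * (2 : ℝ) ^ n⌋ : ℝ) * (2 : ℝ) ^ (-n))
      (((⌊t * (2 : ℝ) ^ n⌋ : ℝ) + 1) * (2 : ℝ) ^ (-n)), G s = c) :
    dyadicAvg G n t = c := by
  rw [dyadicAvg, setIntegral_congr_fun measurableSet_Ico h]
  have h2 : (2 : ℝ) ^ n ≠ 0 := by positivity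
  have h3 : (0 : ℝ) ≤ (2 : ℝ) ^ (-n) := by positivity
  simp only [integral_const, measureReal_restrict_apply_univ, smul_eq_mul]
  rw [Real.volume_real_Ico_of_le (by nlinarith), zpow_neg]
  field_simp
  ring

/-- The square function at `x` dominates each of its martingale differences, provided the
dyadic averages are eventually constant. -/
theorem abs_dyadicAvg_sub_le_sqFnD {G : ℝ → ℝ} (hG : Integrable G) {x : Fin 1 → ℝ} {N : ℕ}
    {c : ℝ} (hc : ∀ n : ℕ, N ≤ n → dyadicAvg G n (x 0) = c) (n : ℤ) :
    |dyadicAvg G (n + 1) (x 0) - dyadicAvg G n (x 0)| ≤ sqFnD 1 (fun y => G (y 0)) x := by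
  set D : ℤ → ℝ := fun m => (dyadicAvg G (m + 1) (x 0) - dyadicAvg G m (x 0)) ^ 2 with hD
  set i : ℤ → ℤ × (Fin 1 → ℤ) := fun m => (m, fun _ => ⌊x 0 * (2 : ℝ) ^ m⌋) with hi
  have hinj : Function.Injective i := fun a b h => (Prod.ext_iff.1 h).1
  set F : ℤ × (Fin 1 → ℤ) → ℝ := fun q => (deltaCube 1 (fun y => G (y 0)) q.1 q.2 x) ^ 2
    with hF
  have hFi : F ∘ i = D := by
    funext m
    simp [hF, hi, hD, deltaCube_one]
  have hoff : ∀ q ∉ Set.range i, F q = 0 := by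
    rintro ⟨m, k⟩ hq
    have : ¬ ⌊x 0 * (2 : ℝ) ^ m⌋ = k 0 := by
      intro h
      refine hq ⟨m, ?_⟩
      simp only [hi, Prod.mk.injEq, true_and]
      funext j
      rw [Subsingleton.elim j 0, h]
    simp [hF, deltaCube_one, this]
  have hDs : Summable D := by
    refine Summable.of_nat_of_neg ?_ ?_
    · refine summable_of_ne_finset_zero (s := Finset.range N) fun m hm => ?_
      have hm' : N ≤ m := by simpa using hm
      have h1 := hc (m + 1) (by omega)
      push_cast at h1
      simp [hD, h1, hc m hm']
    · refine Summable.of_nonneg_of_le (fun m => sq_nonneg _) (fun m => ?_)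
        ((summable_geometric_of_lt_one (r := (1 / 4 : ℝ)) (by norm_num) (by norm_num)).mul_left
          (9 * (∫ s, |G s|) ^ 2))
      have h1 := abs_dyadicAvg_le hG (-(m : ℤ) + 1) (x 0)
      have h2 := abs_dyadicAvg_le hG (-(m : ℤ)) (x 0)
      have h3 : |dyadicAvg G (-(m : ℤ) + 1) (x 0) - dyadicAvg G (-(m : ℤ)) (x 0)| ≤
          3 * ((2 : ℝ) ^ (-(m : ℤ)) * ∫ s, |G s|) := by
        refine (abs_sub _ _).trans ?_
        rw [zpow_add_one₀ two_ne_zero] at h1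
        linarith
      calc D (-(m : ℤ)) ≤ (3 * ((2 : ℝ) ^ (-(m : ℤ)) * ∫ s, |G s|)) ^ 2 := by
            exact (sq_abs _).ge.trans (pow_le_pow_left₀ (abs_nonneg _) h3 2)
        _ = 9 * (∫ s, |G s|) ^ 2 * (1 / 4) ^ m := by
            rw [zpow_neg, zpow_natCast, show (1 / 4 : ℝ) = ((2 : ℝ)⁻¹) ^ 2 by norm_num, ← pow_mul,
              mul_comm 2 m, pow_mul, inv_pow]
            ring
  have hFs : Summable F := (hinj.summable_iff hoff).1 (hFi ▸ hDs)
  rw [sqFnD, ← Real.sqrt_sq_eq_abs]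
  refine Real.sqrt_le_sqrt ?_
  have h := hFs.le_tsum (i n) fun q _ => sq_nonneg _
  have h2 : F (i n) = D n := congrFun hFi n
  rw [h2] at h
  exact h

/-- The power weight `δ |t| ^ (δ - 1)` on the line. -/
def powWeight (δ t : ℝ) : ℝ := δ * |t| ^ (δ - 1)

theorem measurable_powWeight (δ : ℝ) : Measurable (powWeight δ) :=
  (measurable_norm.pow_const (δ - 1)).const_mul δ

theorem powWeight_nonneg {δ : ℝ} (hδ : 0 < δ) (t : ℝ) : 0 ≤ powWeight δ t := by
  unfold powWeight; positivity

theorem powWeight_pos {δ : ℝ} (hδ : 0 < δ) {t : ℝ} (ht : t ≠ 0) : 0 < powWeight δ t := by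
  unfold powWeight; positivity

theorem intervalIntegrable_powWeight_zero {δ : ℝ} (hδ : 0 < δ) {L : ℝ} (hL : 0 ≤ L) :
    IntervalIntegrable (powWeight δ) volume 0 L := by
  refine (((intervalIntegral.intervalIntegrable_rpow' (a := 0) (b := L)
    (by linarith : -1 < δ - 1))).const_mul δ).congr ?_
  intro t ht
  rw [uIoc_of_le hL] at ht
  simp [powWeight, abs_of_pos ht.1]

theorem integral_powWeight_zero {δ : ℝ} (hδ : 0 < δ) {L : ℝ} (hL : 0 ≤ L) :
    ∫ t in (0 : ℝ)..L, powWeight δ t = L ^ δ := by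
  have h : ∫ t in (0 : ℝ)..L, powWeight δ t = ∫ t in (0 : ℝ)..L, δ * t ^ (δ - 1) := by
    refine intervalIntegral.integral_congr fun t ht => ?_
    rw [uIcc_of_le hL] at ht
    simp [powWeight, abs_of_nonneg ht.1]
  rw [h, intervalIntegral.integral_const_mul, integral_rpow (Or.inl (by linarith)),
    sub_add_cancel, Real.zero_rpow hδ.ne']
  field_simp
  ring

theorem powWeight_neg (δ t : ℝ) : powWeight δ (-t) = powWeight δ t := by simp [powWeight]

theorem intervalIntegrable_powWeight_symm {δ : ℝ} (hδ : 0 < δ) {L : ℝ} (hL : 0 ≤ L) :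
    IntervalIntegrable (powWeight δ) volume (-L) L := by
  have h := intervalIntegrable_powWeight_zero hδ hL
  have h2 := (IntervalIntegrable.iff_comp_neg (by simp)).1 h
  simp only [powWeight_neg, neg_zero] at h2
  exact h2.symm.trans h

theorem integral_powWeight_symm {δ : ℝ} (hδ : 0 < δ) {L : ℝ} (hL : 0 ≤ L) :
    ∫ t in (-L)..L, powWeight δ t = 2 * L ^ δ := by
  have h := intervalIntegrable_powWeight_zero hδ hL
  have h2 := (IntervalIntegrable.iff_comp_neg (by simp)).1 h
  simp only [powWeight_neg, neg_zero] at h2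
  rw [← intervalIntegral.integral_add_adjacent_intervals h2.symm h]
  have h3 := intervalIntegral.integral_comp_neg (a := 0) (b := L) (powWeight δ)
  simp only [powWeight_neg, neg_zero] at h3
  rw [← h3, integral_powWeight_zero hδ hL]
  ring

theorem Ico_subset_Icc_max_abs (a b : ℝ) :
    Set.Ico a b ⊆ Set.Icc (-max |a| |b|) (max |a| |b|) := fun t ht =>
  ⟨by linarith [neg_abs_le a, le_max_left |a| |b|, ht.1],
    by linarith [le_abs_self b, le_max_right |a| |b|, ht.2]⟩

theorem integrableOn_powWeight_Icc {δ : ℝ} (hδ : 0 < δ) {L : ℝ} (hL : 0 ≤ L) :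
    IntegrableOn (powWeight δ) (Set.Icc (-L) L) :=
  (intervalIntegrable_iff_integrableOn_Icc_of_le (by linarith)).1
    (intervalIntegrable_powWeight_symm hδ hL)

theorem integrableOn_powWeight_Ico {δ : ℝ} (hδ : 0 < δ) (a b : ℝ) :
    IntegrableOn (powWeight δ) (Set.Ico a b) :=
  (integrableOn_powWeight_Icc hδ (le_max_of_le_left (abs_nonneg a))).mono_set
    (Ico_subset_Icc_max_abs a b)

theorem setIntegral_powWeight_Ico_zero {δ : ℝ} (hδ : 0 < δ) {L : ℝ} (hL : 0 ≤ L) :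
    ∫ t in Set.Ico 0 L, powWeight δ t = L ^ δ := by
  rw [integral_Ico_eq_integral_Ioc, ← intervalIntegral.integral_of_le hL,
    integral_powWeight_zero hδ hL]

/-- The average of the power weight over `[a, b)` is controlled by its value at the endpoint
farthest from the origin. -/
theorem average_powWeight_le {δ : ℝ} (hδ : 0 < δ) (hδ1 : δ < 1) {a b : ℝ} (hab : a < b) :
    (b - a)⁻¹ * ∫ t in Set.Ico a b, powWeight δ t ≤ 4 * max |a| |b| ^ (δ - 1) := by
  set L := max |a| |b| with hL
  have haL : |a| ≤ L := le_max_left _ _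
  have hbL : |b| ≤ L := le_max_right _ _
  have hL0 : 0 < L := by
    by_contra h
    have h1 : a = 0 := abs_eq_zero.1 (le_antisymm (by linarith) (abs_nonneg a))
    have h2 : b = 0 := abs_eq_zero.1 (le_antisymm (by linarith) (abs_nonneg b))
    linarith
  have hba : 0 < b - a := sub_pos.2 hab
  rw [inv_mul_le_iff₀ hba]
  rcases le_or_gt (L / 2) (b - a) with h | h
  · have h1 : ∫ t in Set.Ico a b, powWeight δ t ≤ 2 * L ^ δ := by
      rw [← integral_powWeight_symm hδ hL0.le,
        intervalIntegral.integral_of_le (by linarith : -L ≤ L), ← integral_Icc_eq_integral_Ioc]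
      exact setIntegral_mono_set (integrableOn_powWeight_Icc hδ hL0.le)
        (ae_of_all _ fun t => powWeight_nonneg hδ t)
        (Ico_subset_Icc_max_abs a b).eventuallyLE
    have h2 : L ^ δ = L * L ^ (δ - 1) := by
      rw [← Real.rpow_one_add' hL0.le (by linarith)]; ring_nf
    have h3 : 0 < L ^ (δ - 1) := by positivity
    nlinarith
  · have hfar : ∀ t ∈ Set.Ico a b, L / 2 ≤ |t| := by
      intro t ht
      have h1 : |a - t| ≤ b - a := by rw [abs_le]; constructor <;> linarith [ht.1, ht.2]
      have h2 : |b - t| ≤ b - a := by rw [abs_le]; constructor <;> linarith [ht.1, ht.2]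
      have h3 := abs_sub_abs_le_abs_sub a t
      have h4 := abs_sub_abs_le_abs_sub b t
      rcases max_choice |a| |b| with h5 | h5 <;> rw [← hL] at h5 <;> linarith
    have hval : ∀ t ∈ Set.Ico a b, powWeight δ t ≤ 4 * L ^ (δ - 1) := by
      intro t ht
      have h1 : |t| ^ (δ - 1) ≤ (L / 2) ^ (δ - 1) :=
        Real.rpow_le_rpow_of_nonpos (by positivity) (hfar t ht) (by linarith)
      have h2 : (L / 2) ^ (δ - 1) = L ^ (δ - 1) * 2 ^ (1 - δ) := by
        rw [Real.div_rpow hL0.le zero_le_two, ← neg_sub 1 δ, Real.rpow_neg zero_le_two]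
        field_simp
      have h3 : (2 : ℝ) ^ (1 - δ) ≤ 2 := by
        simpa using Real.rpow_le_rpow_of_exponent_le one_le_two (by linarith : 1 - δ ≤ 1)
      have h4 : 0 < L ^ (δ - 1) := by positivity
      have h5 : 0 ≤ |t| ^ (δ - 1) := by positivity
      unfold powWeight
      nlinarith
    have := setIntegral_mono_on (integrableOn_powWeight_Ico hδ a b)
      (integrableOn_const (by simp)) measurableSet_Ico hval
    simpa [Real.volume_real_Ico_of_le hab.le] using this

theorem isWeightD_powWeight {δ : ℝ} (hδ : 0 < δ) :
    IsWeightD 1 (fun x => powWeight δ (x 0)) := by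
  refine ⟨(measurable_powWeight δ).comp (measurable_pi_apply 0), ?_, fun a b _ =>
    integrableOn_cubeD_one (integrableOn_powWeight_Ico hδ _ _)⟩
  filter_upwards [ae_fin_one_ne_zero] with x hx using powWeight_pos hδ hx

theorem continuous_abs_rpow {γ : ℝ} (hγ : 0 ≤ γ) : Continuous fun t : ℝ => |t| ^ γ :=
  continuous_abs.rpow_const fun _ => Or.inr hγ

theorem integrableOn_abs_rpow_Ico {γ : ℝ} (hγ : 0 ≤ γ) (a b : ℝ) :
    IntegrableOn (fun t : ℝ => |t| ^ γ) (Set.Ico a b) :=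
  ((continuous_abs_rpow hγ).continuousOn.integrableOn_Icc).mono_set Set.Ico_subset_Icc_self

theorem isWeightD_abs_rpow {γ : ℝ} (hγ : 0 ≤ γ) :
    IsWeightD 1 (fun x => |x 0| ^ γ) := by
  refine ⟨(continuous_abs_rpow hγ).measurable.comp (measurable_pi_apply 0), ?_, fun a b _ =>
    integrableOn_cubeD_one (integrableOn_abs_rpow_Ico hγ _ _)⟩
  filter_upwards [ae_fin_one_ne_zero] with x hx
  positivity

theorem average_abs_rpow_le {γ : ℝ} (hγ : 0 ≤ γ) {a b : ℝ} (hab : a < b) :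
    (b - a)⁻¹ * ∫ t in Set.Ico a b, |t| ^ γ ≤ max |a| |b| ^ γ := by
  rw [inv_mul_le_iff₀ (sub_pos.2 hab)]
  have hval : ∀ t ∈ Set.Ico a b, |t| ^ γ ≤ max |a| |b| ^ γ := fun t ht =>
    Real.rpow_le_rpow (abs_nonneg t) (abs_le.2 (Ico_subset_Icc_max_abs a b ht)) hγ
  have := setIntegral_mono_on (integrableOn_abs_rpow_Ico hγ a b)
    (integrableOn_const (by simp)) measurableSet_Ico hval
  simpa [Real.volume_real_Ico_of_le hab.le] using this

theorem apCharD_powWeight_le {p δ : ℝ} (hp : 1 < p) (hδ : 0 < δ) (hδ1 : δ < 1) :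
    apCharD 1 p (fun x => |x 0| ^ ((1 - δ) * (p - 1))) (fun x => powWeight δ (x 0)) ≤
      ENNReal.ofReal (4 ^ (p - 1)) := by
  refine iSup_le fun a => iSup_le fun b => iSup_le fun hab => ENNReal.ofReal_le_ofReal ?_
  have hγ : 0 ≤ (1 - δ) * (p - 1) := mul_nonneg (by linarith) (by linarith)
  rw [cubeAvg_one (fun t => |t| ^ ((1 - δ) * (p - 1))), cubeAvg_one]
  have h1 := average_abs_rpow_le hγ (hab 0)
  have h2 := average_powWeight_le hδ hδ1 (hab 0)
  set L := max |a 0| |b 0| with hL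
  have hba : 0 < b 0 - a 0 := sub_pos.2 (hab 0)
  have hnn : 0 ≤ (b 0 - a 0)⁻¹ * ∫ t in Set.Ico (a 0) (b 0), powWeight δ t :=
    mul_nonneg (by positivity) (setIntegral_nonneg measurableSet_Ico
      fun t _ => powWeight_nonneg hδ t)
  have hL0 : 0 < L := by
    rcases eq_or_ne (a 0) 0 with h | h
    · exact lt_max_of_lt_right (abs_pos.2 (by have := hab 0; rw [h] at this; exact this.ne'))
    · exact lt_max_of_lt_left (abs_pos.2 h)
  calc _ ≤ L ^ ((1 - δ) * (p - 1)) * (4 * L ^ (δ - 1)) ^ (p - 1) := by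
        refine mul_le_mul h1 (Real.rpow_le_rpow hnn h2 (by linarith)) (by positivity)
          (by positivity)
    _ = 4 ^ (p - 1) := by
        rw [Real.mul_rpow (by norm_num) (by positivity), ← Real.rpow_mul hL0.le,
          mul_left_comm, ← Real.rpow_add hL0]
        ring_nf
        simp

theorem maxFnD_powWeight_le {δ : ℝ} (hδ : 0 < δ) (hδ1 : δ < 1) (a b : Fin 1 → ℝ)
    {x : Fin 1 → ℝ} (hx : x 0 ≠ 0) :
    maxFnD 1 (fun y => powWeight δ (y 0)) a b x ≤
      ENNReal.ofReal (4 / δ * powWeight δ (x 0)) := by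
  refine iSup_le fun c => iSup_le fun e => iSup_le fun hce => iSup_le fun _ => iSup_le fun hxc =>
    ENNReal.ofReal_le_ofReal ?_
  rw [cubeAvg_one]
  refine (average_powWeight_le hδ hδ1 (hce 0)).trans ?_
  have h1 : |x 0| ≤ max |c 0| |e 0| :=
    abs_le.2 (Ico_subset_Icc_max_abs _ _ (mem_cubeD_one.1 hxc))
  have h2 : 4 / δ * powWeight δ (x 0) = 4 * |x 0| ^ (δ - 1) := by
    unfold powWeight; field_simp
  rw [h2]
  gcongr 4 * ?_
  exact Real.rpow_le_rpow_of_nonpos (by positivity) h1 (by linarith)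

theorem ainfCharD_powWeight_le {δ : ℝ} (hδ : 0 < δ) (hδ1 : δ < 1) :
    ainfCharD 1 (fun x => powWeight δ (x 0)) ≤ ENNReal.ofReal (4 / δ) := by
  refine iSup_le fun a => iSup_le fun b => iSup_le fun hab => ENNReal.div_le_of_le_mul ?_
  have hint : IntegrableOn (fun x : Fin 1 → ℝ => powWeight δ (x 0)) (cubeD 1 a b) :=
    (isWeightD_powWeight hδ).2.2 a b hab
  calc ∫⁻ x in cubeD 1 a b, maxFnD 1 (fun y => powWeight δ (y 0)) a b x
      ≤ ∫⁻ x in cubeD 1 a b, ENNReal.ofReal (4 / δ * powWeight δ (x 0)) :=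
        lintegral_mono_ae (ae_restrict_of_ae (by
          filter_upwards [ae_fin_one_ne_zero] with x hx using maxFnD_powWeight_le hδ hδ1 a b hx))
    _ = ENNReal.ofReal (∫ x in cubeD 1 a b, 4 / δ * powWeight δ (x 0)) :=
        (ofReal_integral_eq_lintegral_ofReal (hint.const_mul _) (ae_of_all _ fun x =>
          mul_nonneg (by positivity) (powWeight_nonneg hδ _))).symm
    _ = _ := by rw [integral_const_mul, ENNReal.ofReal_mul (by positivity)]

theorem one_le_ainfCharD_powWeight {δ : ℝ} (hδ : 0 < δ) :
    1 ≤ ainfCharD 1 (fun x => powWeight δ (x 0)) := by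
  have h01 : ∀ i : Fin 1, (fun _ : Fin 1 => (0 : ℝ)) i < (fun _ : Fin 1 => (1 : ℝ)) i :=
    fun _ => zero_lt_one
  have hσ : ∫ t in Set.Ico 0 1, powWeight δ t = 1 := by
    rw [setIntegral_powWeight_Ico_zero hδ zero_le_one, Real.one_rpow]
  refine le_trans ?_ (le_iSup_of_le (fun _ => 0) (le_iSup_of_le (fun _ => 1)
    (le_iSup_of_le h01 le_rfl)))
  rw [setIntegral_cubeD_one, hσ, ENNReal.ofReal_one, div_one]
  have hvol : volume (cubeD 1 (fun _ => (0 : ℝ)) (fun _ => 1)) = 1 := by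
    simp [cubeD, volume_pi_pi]
  calc (1 : ℝ≥0∞) = ∫⁻ x in cubeD 1 (fun _ => (0 : ℝ)) (fun _ => 1), 1 := by simp [hvol]
    _ ≤ _ := by
      refine setLIntegral_mono' ?_ fun x hx => ?_
      · exact MeasurableSet.univ_pi fun i => measurableSet_Ico
      · refine le_iSup_of_le (fun _ => 0) (le_iSup_of_le (fun _ => 1) (le_iSup_of_le h01
          (le_iSup_of_le subset_rfl (le_iSup_of_le hx ?_))))
        rw [cubeAvg_one, hσ]
        simp

/-- A version of the power weight on `(0, 1)` that is constant on each interval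
`[2 ^ (-k - 1), 2 ^ (-k))`, and vanishes off `(0, 1)`. -/
def stepWeight (δ : ℝ) : ℝ → ℝ :=
  (Set.Ioo 0 1).indicator fun t => δ * (2 : ℝ) ^ (((⌊Real.logb 2 t⌋ : ℝ) + 1) * (δ - 1))

theorem measurable_stepWeight (δ : ℝ) : Measurable (stepWeight δ) := by
  refine Measurable.indicator (Measurable.const_mul ?_ δ) measurableSet_Ioo
  have h : Measurable fun t : ℝ => (⌊Real.logb 2 t⌋ : ℝ) :=
    (measurable_from_top (f := fun m : ℤ => (m : ℝ))).comp
      (Int.measurable_floor.comp (Real.measurable_log.div_const _))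
  exact measurable_const.pow ((h.add_const 1).mul_const _)

theorem stepWeight_nonneg {δ : ℝ} (hδ : 0 < δ) (t : ℝ) : 0 ≤ stepWeight δ t :=
  Set.indicator_nonneg (fun t _ => by positivity) t

theorem stepWeight_le_powWeight {δ : ℝ} (hδ : 0 < δ) (hδ1 : δ < 1) (t : ℝ) :
    stepWeight δ t ≤ powWeight δ t := by
  by_cases ht : t ∈ Set.Ioo (0 : ℝ) 1
  · rw [stepWeight, Set.indicator_of_mem ht, powWeight, abs_of_pos ht.1]
    gcongr
    nth_rewrite 2 [← Real.rpow_logb two_pos (by norm_num) ht.1]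
    rw [← Real.rpow_mul zero_le_two]
    refine Real.rpow_le_rpow_of_exponent_le one_le_two ?_
    nlinarith [Int.lt_floor_add_one (Real.logb 2 t)]
  · rw [stepWeight, Set.indicator_of_notMem ht]
    exact powWeight_nonneg hδ t

theorem powWeight_le_two_mul_stepWeight {δ : ℝ} (hδ : 0 < δ) (hδ1 : δ < 1) {t : ℝ}
    (ht : t ∈ Set.Ioo (0 : ℝ) 1) : powWeight δ t ≤ 2 * stepWeight δ t := by
  rw [stepWeight, Set.indicator_of_mem ht, powWeight, abs_of_pos ht.1, mul_left_comm]
  gcongr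
  nth_rewrite 1 [← Real.rpow_logb two_pos (by norm_num) ht.1]
  rw [← Real.rpow_mul zero_le_two, ← Real.rpow_one_add' zero_le_two]
  · refine Real.rpow_le_rpow_of_exponent_le one_le_two ?_
    nlinarith [Int.floor_le (Real.logb 2 t)]
  · have h : (⌊Real.logb 2 t⌋ : ℝ) + 1 ≤ 0 := by
      have : ⌊Real.logb 2 t⌋ < 0 :=
        Int.floor_lt.2 (by simpa using Real.logb_neg one_lt_two ht.1 ht.2)
      exact_mod_cast this
    nlinarith

theorem stepWeight_eq {δ t : ℝ} {k : ℕ}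
    (ht : t ∈ Set.Ico ((2 : ℝ) ^ (-(k : ℤ) - 1)) ((2 : ℝ) ^ (-(k : ℤ)))) :
    stepWeight δ t = δ * (2 : ℝ) ^ ((k : ℝ) * (1 - δ)) := by
  have h0 : 0 < t := lt_of_lt_of_le (by positivity) ht.1
  have h1 : t < 1 := ht.2.trans_le (zpow_le_one_of_nonpos₀ one_le_two (by simp))
  have hfl : ⌊Real.logb 2 t⌋ = -(k : ℤ) - 1 := by
    rw [Int.floor_eq_iff, Real.le_logb_iff_rpow_le one_lt_two h0,
      Real.logb_lt_iff_lt_rpow one_lt_two h0]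
    constructor
    · rw [Real.rpow_intCast]; exact ht.1
    · have h := ht.2
      rw [← Real.rpow_intCast] at h
      simpa using h
  rw [stepWeight, Set.indicator_of_mem (Set.mem_Ioo.2 ⟨h0, h1⟩), hfl]
  push_cast
  ring_nf

theorem integrable_stepWeight {δ : ℝ} (hδ : 0 < δ) (hδ1 : δ < 1) :
    Integrable (stepWeight δ) := by
  have h : IntegrableOn (stepWeight δ) (Set.Ioo 0 1) := by
    refine Integrable.mono' ((integrableOn_powWeight_Ico hδ 0 1).mono_set Set.Ioo_subset_Ico_self)
      (measurable_stepWeight δ).aestronglyMeasurable (ae_of_all _ fun t => ?_)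
    rw [Real.norm_of_nonneg (stepWeight_nonneg hδ t)]
    exact stepWeight_le_powWeight hδ hδ1 t
  exact (integrableOn_iff_integrable_of_support_subset Set.support_indicator_subset).1 h

theorem exists_mem_Ico_two_zpow_neg {t : ℝ} (ht : t ∈ Set.Ioo (0 : ℝ) 1) :
    ∃ k : ℕ, t ∈ Set.Ico ((2 : ℝ) ^ (-(k : ℤ) - 1)) ((2 : ℝ) ^ (-(k : ℤ))) := by
  obtain ⟨m, hm⟩ := exists_mem_Ico_zpow ht.1 one_lt_two
  have hm0 : m < 0 := by
    by_contra h
    have := one_le_zpow₀ (one_le_two (α := ℝ)) (not_lt.1 h)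
    linarith [hm.1, ht.2]
  refine ⟨(-m - 1).toNat, ?_⟩
  have : ((-m - 1).toNat : ℤ) = -m - 1 := Int.toNat_of_nonneg (by omega)
  rwa [this, show -(-m - 1) - 1 = m by ring, show -(-m - 1) = m + 1 by ring]

/-- On `[2 ^ (-k - 1), 2 ^ (-k))` the fine dyadic averages of the step weight are constant. -/
theorem dyadicAvg_stepWeight_fine {δ t : ℝ} {k n : ℕ} (hn : k + 1 ≤ n)
    (ht : t ∈ Set.Ico ((2 : ℝ) ^ (-(k : ℤ) - 1)) ((2 : ℝ) ^ (-(k : ℤ)))) :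
    dyadicAvg (stepWeight δ) n t = δ * (2 : ℝ) ^ ((k : ℝ) * (1 - δ)) := by
  refine dyadicAvg_of_eqOn_const fun s hs => stepWeight_eq ?_
  obtain ⟨j, rfl⟩ := Nat.exists_eq_add_of_le hn
  have hP : (0 : ℝ) < (2 : ℝ) ^ ((k + 1 + j : ℕ) : ℤ) := by positivity
  have e1 : (2 : ℝ) ^ (-(k : ℤ) - 1) * (2 : ℝ) ^ ((k + 1 + j : ℕ) : ℤ) = (2 : ℝ) ^ j := by
    rw [← zpow_add₀ two_ne_zero, ← zpow_natCast]; congr 1; push_cast; ring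
  have e2 : (2 : ℝ) ^ (-(k : ℤ)) * (2 : ℝ) ^ ((k + 1 + j : ℕ) : ℤ) = (2 : ℝ) ^ (j + 1) := by
    rw [← zpow_add₀ two_ne_zero, ← zpow_natCast]; congr 1; push_cast; ring
  have h1 : (2 : ℤ) ^ j ≤ ⌊t * (2 : ℝ) ^ ((k + 1 + j : ℕ) : ℤ)⌋ := by
    rw [Int.le_floor]
    push_cast only [Int.cast_pow, Int.cast_ofNat]
    rw [← e1]
    exact mul_le_mul_of_nonneg_right ht.1 hP.le
  have h2 : ⌊t * (2 : ℝ) ^ ((k + 1 + j : ℕ) : ℤ)⌋ + 1 ≤ (2 : ℤ) ^ (j + 1) := by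
    rw [Int.add_one_le_iff, Int.floor_lt]
    push_cast only [Int.cast_pow, Int.cast_ofNat]
    rw [← e2]
    exact mul_lt_mul_of_pos_right ht.2 hP
  have h1' : (2 : ℝ) ^ j ≤ (⌊t * (2 : ℝ) ^ ((k + 1 + j : ℕ) : ℤ)⌋ : ℝ) := by exact_mod_cast h1
  have h2' : (⌊t * (2 : ℝ) ^ ((k + 1 + j : ℕ) : ℤ)⌋ : ℝ) + 1 ≤ (2 : ℝ) ^ (j + 1) := by
    exact_mod_cast h2
  rw [zpow_neg, ← div_eq_mul_inv, ← div_eq_mul_inv] at hs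
  refine ⟨le_trans ?_ hs.1, hs.2.trans_le ?_⟩
  · rwa [le_div_iff₀ hP, e1]
  · rwa [div_le_iff₀ hP, e2]

theorem le_dyadicAvg_stepWeight_coarse {δ t : ℝ} (hδ : 0 < δ) (hδ1 : δ < 1) {k : ℕ}
    (ht : t ∈ Set.Ico ((2 : ℝ) ^ (-(k : ℤ) - 1)) ((2 : ℝ) ^ (-(k : ℤ)))) :
    1 / 2 * (2 : ℝ) ^ ((k : ℝ) * (1 - δ)) ≤ dyadicAvg (stepWeight δ) k t := by
  have hP : (0 : ℝ) < (2 : ℝ) ^ (k : ℤ) := by positivity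
  have h0 : 0 < t := lt_of_lt_of_le (by positivity) ht.1
  have hfl : ⌊t * (2 : ℝ) ^ (k : ℤ)⌋ = 0 := by
    rw [Int.floor_eq_zero_iff]
    refine ⟨by positivity, ?_⟩
    have h := mul_lt_mul_of_pos_right ht.2 hP
    rwa [← zpow_add₀ two_ne_zero, neg_add_cancel, zpow_zero] at h
  rw [dyadicAvg, hfl, Int.cast_zero, zero_mul, zero_add, one_mul]
  set L := (2 : ℝ) ^ (-(k : ℤ)) with hL
  have hL0 : 0 < L := by positivity
  have hL1 : L ≤ 1 := zpow_le_one_of_nonpos₀ one_le_two (by simp)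
  have hint : L ^ δ ≤ 2 * ∫ s in Set.Ico 0 L, stepWeight δ s := by
    rw [← setIntegral_powWeight_Ico_zero hδ hL0.le, ← integral_const_mul]
    simp only [integral_Ico_eq_integral_Ioo]
    refine setIntegral_mono_on ((integrableOn_powWeight_Ico hδ 0 L).mono_set
      Set.Ioo_subset_Ico_self) ((integrable_stepWeight hδ hδ1).const_mul 2).integrableOn
      measurableSet_Ioo fun s hs =>
        powWeight_le_two_mul_stepWeight hδ hδ1 ⟨hs.1, hs.2.trans_le hL1⟩
  have hpow : (2 : ℝ) ^ ((k : ℝ) * (1 - δ)) = (2 : ℝ) ^ (k : ℤ) * L ^ δ := by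
    rw [hL, ← Real.rpow_intCast, ← Real.rpow_intCast, ← Real.rpow_mul zero_le_two,
      ← Real.rpow_add two_pos]
    push_cast
    ring_nf
  rw [hpow]
  nlinarith

theorem le_sqFnD_stepWeight {δ : ℝ} (hδ : 0 < δ) (hδ4 : δ ≤ 1 / 4) {x : Fin 1 → ℝ}
    (hx : x 0 ∈ Set.Ioo (0 : ℝ) 1) :
    1 / 8 * (x 0) ^ (δ - 1) ≤ sqFnD 1 (fun y => stepWeight δ (y 0)) x := by
  have hδ1 : δ < 1 := by linarith
  obtain ⟨k, hk⟩ := exists_mem_Ico_two_zpow_neg hx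
  have hle := abs_dyadicAvg_sub_le_sqFnD (integrable_stepWeight hδ hδ1) (x := x)
    (fun n hn => dyadicAvg_stepWeight_fine hn hk) (k : ℤ)
  refine le_trans ?_ hle
  have h1 := dyadicAvg_stepWeight_fine (δ := δ) le_rfl hk
  push_cast at h1
  rw [h1, abs_sub_comm]
  refine le_trans ?_ (le_abs_self _)
  have h2 := le_dyadicAvg_stepWeight_coarse hδ hδ1 hk
  have h3 := powWeight_le_two_mul_stepWeight hδ hδ1 hx
  rw [stepWeight_eq hk, powWeight, abs_of_pos hx.1, mul_left_comm] at h3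
  have h4 := le_of_mul_le_mul_left h3 hδ
  have h5 : (0 : ℝ) < (2 : ℝ) ^ ((k : ℝ) * (1 - δ)) := by positivity
  nlinarith

/-- Lower bound for the weighted norm of the square function of the step weight. -/
theorem le_pNormD_sqFnD_stepWeight {p δ : ℝ} (hp : 1 < p) (hδ : 0 < δ) (hδ4 : δ ≤ 1 / 4) :
    ENNReal.ofReal (1 / 8 * (1 / δ) ^ (1 / p)) ≤
      pNormD 1 p (sqFnD 1 fun y => stepWeight δ (y 0))
        (fun x => |x 0| ^ ((1 - δ) * (p - 1))) := by
  have hp0 : 0 < p := by linarith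
  have hkey : ENNReal.ofReal ((1 / 8) ^ p * (1 / δ)) ≤
      ∫⁻ x : Fin 1 → ℝ, ENNReal.ofReal (|sqFnD 1 (fun y => stepWeight δ (y 0)) x| ^ p *
        |x 0| ^ ((1 - δ) * (p - 1))) := by
    set G : ℝ → ℝ≥0∞ := (Set.Ioo 0 1).indicator fun t =>
      ENNReal.ofReal ((1 / 8) ^ p * (1 / δ) * powWeight δ t) with hG
    calc ENNReal.ofReal ((1 / 8) ^ p * (1 / δ)) = ∫⁻ t, G t := by
          rw [hG, lintegral_indicator measurableSet_Ioo, ← ofReal_integral_eq_lintegral_ofReal,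
            integral_const_mul, ← integral_Ico_eq_integral_Ioo,
            setIntegral_powWeight_Ico_zero hδ zero_le_one, Real.one_rpow, mul_one]
          · exact ((integrableOn_powWeight_Ico hδ 0 1).mono_set
              Set.Ioo_subset_Ico_self).const_mul _
          · exact ae_of_all _ fun t => mul_nonneg (by positivity) (powWeight_nonneg hδ t)
      _ = ∫⁻ x : Fin 1 → ℝ, G (x 0) := (lintegral_fin_one G).symm
      _ ≤ _ := lintegral_mono fun x => by
          by_cases hx : x 0 ∈ Set.Ioo (0 : ℝ) 1
          · simp only [hG, Set.indicator_of_mem hx]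
            refine ENNReal.ofReal_le_ofReal ?_
            have h := le_sqFnD_stepWeight hδ hδ4 hx
            have hx0 : 0 < x 0 := hx.1
            calc (1 / 8) ^ p * (1 / δ) * powWeight δ (x 0)
                = (1 / 8 * (x 0) ^ (δ - 1)) ^ p * |x 0| ^ ((1 - δ) * (p - 1)) := by
                  rw [powWeight, abs_of_pos hx0, Real.mul_rpow (by norm_num) (by positivity),
                    ← Real.rpow_mul hx0.le, mul_assoc (_ ^ p) (_ ^ (_ * p)),
                    ← Real.rpow_add hx0]
                  rw [show (δ - 1) * p + (1 - δ) * (p - 1) = δ - 1 by ring]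
                  field_simp
              _ ≤ _ := by
                  gcongr
                  exact h.trans (le_abs_self _)
          · simp [hG, Set.indicator_of_notMem hx]
  have h := ENNReal.rpow_le_rpow hkey (by positivity : 0 ≤ 1 / p)
  rw [ENNReal.ofReal_rpow_of_nonneg (by positivity) (by positivity),
    Real.mul_rpow (by positivity) (by positivity), ← Real.rpow_mul (by norm_num),
    mul_one_div_cancel hp0.ne', Real.rpow_one] at h
  exact h

theorem pNormD_stepWeight_div_le {p δ : ℝ} (hp : 1 < p) (hδ : 0 < δ) (hδ1 : δ < 1) :
    pNormD 1 p (fun x => stepWeight δ (x 0) / powWeight δ (x 0))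
      (fun x => powWeight δ (x 0)) ≤ 1 := by
  have hp0 : 0 < p := by linarith
  refine ENNReal.rpow_le_one ?_ (by positivity)
  rw [lintegral_fin_one fun t =>
    ENNReal.ofReal (|stepWeight δ t / powWeight δ t| ^ p * powWeight δ t)]
  calc _ ≤ ∫⁻ t, (Set.Ioo 0 1).indicator (fun t => ENNReal.ofReal (powWeight δ t)) t := by
        refine lintegral_mono fun t => ?_
        by_cases ht : t ∈ Set.Ioo (0 : ℝ) 1
        · rw [Set.indicator_of_mem ht]
          refine ENNReal.ofReal_le_ofReal (mul_le_of_le_one_left (powWeight_nonneg hδ t) ?_)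
          refine Real.rpow_le_one (abs_nonneg _) ?_ hp0.le
          rw [abs_of_nonneg (div_nonneg (stepWeight_nonneg hδ t) (powWeight_nonneg hδ t))]
          exact div_le_one_of_le₀ (stepWeight_le_powWeight hδ hδ1 t) (powWeight_nonneg hδ t)
        · simp [stepWeight, Set.indicator_of_notMem ht, Real.zero_rpow hp0.ne']
    _ = 1 := by
        rw [lintegral_indicator measurableSet_Ioo, ← ofReal_integral_eq_lintegral_ofReal
          ((integrableOn_powWeight_Ico hδ 0 1).mono_set Set.Ioo_subset_Ico_self)
          (ae_of_all _ fun t => powWeight_nonneg hδ t), ← integral_Ico_eq_integral_Ioo,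
          setIntegral_powWeight_Ico_zero hδ zero_le_one, Real.one_rpow, ENNReal.ofReal_one]

theorem stepWeight_div_mul_powWeight {δ : ℝ} (hδ : 0 < δ) (t : ℝ) :
    stepWeight δ t / powWeight δ t * powWeight δ t = stepWeight δ t := by
  rcases eq_or_ne t 0 with rfl | ht
  · simp [stepWeight]
  · exact div_mul_cancel₀ _ (powWeight_pos hδ ht).ne'

/-- Let `p ∈ (1,2]` and let `ψ : [1,∞) → [1,∞)` be increasing with
`ψ(1) = 1`, such that for every `d ≥ 1` and all weights `w, σ` on `ℝ^d` with
`[σ]_{A_∞} < ∞` one has `‖S(·σ)‖_{L^p(σ)→L^p(w)} ≤ C(p,d) [w,σ]_{A_p}^{1/p} ψ([σ]_{A_∞})`.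
Then there is an absolute constant `A > 0` with `ψ(x) ≥ c_p x^{1/p}` for all `x > A`,
where `c_p > 0` depends only on `p`. -/
theorem statement1 (p : ℝ) (hp1 : 1 < p) (hp2 : p ≤ 2)
    (ψ : ℝ → ℝ) (hψmono : MonotoneOn ψ (Set.Ici 1)) (hψ1 : ψ 1 = 1)
    (hψmaps : ∀ x : ℝ, 1 ≤ x → 1 ≤ ψ x)
    (H : ∀ d : ℕ, 0 < d → ∃ C : ℝ, 0 < C ∧
      ∀ w σ : (Fin d → ℝ) → ℝ, IsWeightD d w → IsWeightD d σ → ainfCharD d σ < ⊤ →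
        ∀ f : (Fin d → ℝ) → ℝ, Measurable f →
          pNormD d p (sqFnD d (fun y => f y * σ y)) w ≤
            ENNReal.ofReal C * (apCharD d p w σ) ^ (1/p) *
              ENNReal.ofReal (ψ ((ainfCharD d σ).toReal)) * pNormD d p f σ) :
    ∃ A > (0:ℝ), ∃ c > (0:ℝ), ∀ x : ℝ, A < x → c * x ^ (1/p) ≤ ψ x := by
  obtain ⟨C, hC, hH⟩ := H 1 one_pos
  refine ⟨16, by norm_num, (1 / 4) ^ (1 / p) / (8 * (C * (4 ^ (p - 1)) ^ (1 / p))),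
    by positivity, fun x hx => ?_⟩
  set δ : ℝ := 4 / x with hδdef
  have hx0 : 0 < x := by linarith
  have hδ : 0 < δ := by positivity
  have hδ4 : δ ≤ 1 / 4 := by rw [hδdef, div_le_iff₀ hx0]; linarith
  have hδ1 : δ < 1 := by linarith
  have hxδ : 4 / δ = x := by rw [hδdef]; field_simp
  have hγ : 0 ≤ (1 - δ) * (p - 1) := mul_nonneg (by linarith) (by linarith)
  have hup := ainfCharD_powWeight_le hδ hδ1
  have hlow := one_le_ainfCharD_powWeight hδ
  have hfin := hup.trans_lt ENNReal.ofReal_lt_top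
  rw [hxδ] at hup
  have hup' := ENNReal.toReal_le_of_le_ofReal hx0.le hup
  have hlow' : 1 ≤ (ainfCharD 1 fun x => powWeight δ (x 0)).toReal := by
    simpa using ENNReal.toReal_mono hfin.ne hlow
  have hψx : ψ (ainfCharD 1 fun x => powWeight δ (x 0)).toReal ≤ ψ x :=
    hψmono hlow' (hlow'.trans hup') hup'
  have hψ0 : 0 ≤ ψ x := zero_le_one.trans (hψmaps x (by linarith))
  have hmain := hH _ _ (isWeightD_abs_rpow hγ) (isWeightD_powWeight hδ) hfin
    (fun x => stepWeight δ (x 0) / powWeight δ (x 0))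
    (((measurable_stepWeight δ).div (measurable_powWeight δ)).comp (measurable_pi_apply 0))
  simp only [stepWeight_div_mul_powWeight hδ] at hmain
  have hbound : ENNReal.ofReal (1 / 8 * (1 / δ) ^ (1 / p)) ≤
      ENNReal.ofReal (C * (4 ^ (p - 1)) ^ (1 / p) * ψ x) := by
    refine ((le_pNormD_sqFnD_stepWeight hp1 hδ hδ4).trans hmain).trans ?_
    rw [ENNReal.ofReal_mul (by positivity), ENNReal.ofReal_mul hC.le,
      ← ENNReal.ofReal_rpow_of_nonneg (by positivity) (by positivity)]
    refine mul_le_of_le_of_le_one ?_ (pNormD_stepWeight_div_le hp1 hδ hδ1)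
    gcongr
    exact apCharD_powWeight_le hp1 hδ hδ1
  rw [ENNReal.ofReal_le_ofReal_iff (by positivity)] at hbound
  have hpow : (1 / δ) ^ (1 / p) = (1 / 4) ^ (1 / p) * x ^ (1 / p) := by
    rw [← Real.mul_rpow (by norm_num) hx0.le, ← hxδ]
    congr 1
    field_simp
  rw [hpow] at hbound
  rw [div_mul_eq_mul_div, div_le_iff₀ (by positivity)]
  linarith

end
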